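/- Let F = ℚ(x, y) be the rational function field in two variables. For all σ, π ∈ S_3, S^⧢ Ĩ_{3,1}(x^σ, y^π) = sgn(σ)·sgn(π)·S^⧢ Ĩ_{3,1}(x, y), and moreover S^⧢ Ĩ_{3,1}(y, x) = −S^⧢ Ĩ_{3,1}(x, y) in V_F^{⊗4}. -/

import Mathlib

open scoped TensorProduct
open PiTensorProduct

attribute [local instance] Classical.propDecidable

set_option maxHeartbeats 1000000
set_option synthInstance.maxHeartbeats 400000

noncomputable section

namespace GrassPoly

variable (F : Type) [Field F]

/-- `V_F = F^× ⊗_ℤ ℚ` as a `ℚ`-vector space. -/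
abbrev VF : Type := ℚ ⊗[ℤ] (Additive Fˣ)

variable {F}

/-- The class `[a]` of a nonzero field element in `V_F` (defined to be `0` for `a = 0`). -/
def cls (a : F) : VF F :=
  if h : a = 0 then 0 else (1 : ℚ) ⊗ₜ[ℤ] (Additive.ofMul (Units.mk0 a h))

variable (F) in
/-- Tensor powers of V_F over ℚ. -/
abbrev TP (n : ℕ) : Type := ⨂[ℚ]^n (VF F)

instance instTPAddCommGroup (n : ℕ) : AddCommGroup (TP F n) :=
  Module.addCommMonoidToAddCommGroup ℚ

/-- Appending one extra tensor factor on the right. -/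
def snoc {n : ℕ} : TP F n →ₗ[ℚ] VF F →ₗ[ℚ] TP F (n + 1) :=
  PiTensorProduct.lift
    ((PiTensorProduct.tprod ℚ (s := fun _ : Fin (n + 1) => VF F)).curryRight)

/-- The factor `t_i` appearing in the recursive definition of the symbol,
as a function of `(a_{i-1}, a_i, a_{i+1})`. -/
def tCoef (p a q : F) : VF F :=
  if p = a then (if a = q then 0 else cls (q - a))
  else if a = q then - cls (p - a)
  else cls ((q - a) / (p - a))

/-- The symbol `S I(a₀; a₁, …, a_m; a_{m+1})`, with the middle entries given as a list
(of length `n`). -/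
def SIaux : (n : ℕ) → (a0 : F) → (as : List F) → (b : F) → as.length = n → TP F n
  | 0, _, _, _, _ => tprod ℚ (fun i : Fin 0 => i.elim0)
  | n + 1, a0, as, b, h =>
      ∑ i : Fin (n + 1),
        snoc (SIaux n a0 (as.eraseIdx i.val) b
            (by
              have hi' := i.isLt
              have hi : i.val < as.length := by omega
              have h2 := List.length_eraseIdx_of_lt hi
              omega))
          (tCoef ((a0 :: as).getD i.val 0) (as.getD i.val 0) ((as ++ [b]).getD (i.val + 1) 0))

/-- Cyclic rotation `b₁ ⊗ … ⊗ b_N ↦ b₂ ⊗ … ⊗ b_N ⊗ b₁` on tensor powers. -/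
def rotN (n : ℕ) : TP F n ≃ₗ[ℚ] TP F n :=
  PiTensorProduct.reindex ℚ (fun _ : Fin n => VF F) (finRotate n).symm

/-- Splitting off the last tensor factor. -/
def splitLast (n : ℕ) : TP F (n + 1) ≃ₗ[ℚ] (TP F n) ⊗[ℚ] (VF F) :=
  ((PiTensorProduct.reindex ℚ (fun _ : Fin (n + 1) => VF F)
      (finSumFinEquiv (m := n) (n := 1)).symm).trans
    (PiTensorProduct.tmulEquiv ℚ (VF F)).symm).trans
    (TensorProduct.congr (LinearEquiv.refl ℚ _)
      (PiTensorProduct.subsingletonEquiv (0 : Fin 1)))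

/-- The projector `Π̃_N` annihilating symbols of products. -/
def Pit : (n : ℕ) → TP F n →ₗ[ℚ] TP F n
  | 0 => LinearMap.id
  | 1 => LinearMap.id
  | (n + 2) =>
      ((splitLast (n + 1)).symm.toLinearMap
        ∘ₗ TensorProduct.map (Pit (n + 1)) LinearMap.id
        ∘ₗ (splitLast (n + 1)).toLinearMap)
      ∘ₗ ((LinearMap.id : TP F (n + 2) →ₗ[ℚ] TP F (n + 2)) - (rotN (F := F) (n + 2)).toLinearMap)

/-- The map on `V_F` induced by a field automorphism. -/
def vmap (φ : F ≃+* F) : VF F →ₗ[ℚ] VF F :=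
  TensorProduct.AlgebraTensorModule.map (LinearMap.id : ℚ →ₗ[ℚ] ℚ)
    (AddMonoidHom.toIntLinearMap
      { toFun := fun a => Additive.ofMul ((Units.map (φ : F →* F)) a.toMul)
        map_zero' := by simp
        map_add' := by intro a b; simp [_root_.map_mul] })

/-- The induced map on tensor powers. -/
def tpMap {n : ℕ} (φ : F ≃+* F) : TP F n →ₗ[ℚ] TP F n :=
  PiTensorProduct.map (fun _ => vmap φ)


/-! ### Symbols of (multiple) polylogarithms -/

/-- Symbol of `Li₂`. -/
def SLi2 (x : F) : TP F 2 := - SIaux 2 0 [x⁻¹, 0] 1 rfl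

/-- Symbol of `Li₃`. -/
def SLi3 (x : F) : TP F 3 := - SIaux 3 0 [x⁻¹, 0, 0] 1 rfl

/-- Symbol of `Li₄`. -/
def SLi4 (x : F) : TP F 4 := - SIaux 4 0 [x⁻¹, 0, 0, 0] 1 rfl

/-- Symbol of `Li₅`. -/
def SLi5 (x : F) : TP F 5 := - SIaux 5 0 [x⁻¹, 0, 0, 0, 0] 1 rfl

/-- Symbol of `I_{3,1}(x,y) = I(0; x,0,0,y; 1)`. -/
def SI31 (x y : F) : TP F 4 := SIaux 4 0 [x, 0, 0, y] 1 rfl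

/-- Symbol of `I_{4,1}(x,y) = I(0; x,0,0,0,y; 1)`. -/
def SI41 (x y : F) : TP F 5 := SIaux 5 0 [x, 0, 0, 0, y] 1 rfl

/-- Symbol of `I⁺_{4,1}(x,y) = ½ (I_{4,1}(x,y) + I_{4,1}(x,y⁻¹))`. -/
def I41p (x y : F) : TP F 5 := (2 : ℚ)⁻¹ • (SI41 x y + SI41 x y⁻¹)

/-- The anharmonic orbit of `x`, together with the signs of the
corresponding permutations in `S₃`. -/
def anhList (x : F) : List (ℚ × F) :=
  [(1, x), (1, (1 - x)⁻¹), (1, 1 - x⁻¹), (-1, x⁻¹), (-1, 1 - x), (-1, x / (x - 1))]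

/-- Symbol of `Ĩ_{3,1}(x,y) = (1/36) Σ_{σ,π ∈ S₃} sgn(σ) sgn(π) I_{3,1}(x^σ, y^π)`. -/
def tI31 (x y : F) : TP F 4 :=
  (36 : ℚ)⁻¹ •
    ((anhList x).map (fun p =>
      ((anhList y).map (fun q => (p.1 * q.1) • SI31 p.2 q.2)).sum)).sum

/-- Symbol of `Ĩ⁺_{4,1}(x,y) = (1/6) Σ_{σ ∈ S₃} sgn(σ) I⁺_{4,1}(x^σ, y)`. -/
def tI41p (x y : F) : TP F 5 :=
  (6 : ℚ)⁻¹ • ((anhList x).map (fun p => p.1 • I41p p.2 y)).sum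

/-- Symbol of `V(z; x, y) = Ĩ_{3,1}(z, [x]+[y]+[(1-x)/(1-xy)]+[1-xy]+[(1-y)/(1-xy)])`. -/
def Vc (z x y : F) : TP F 4 :=
  tI31 z x + tI31 z y + tI31 z ((1 - x) / (1 - x * y)) + tI31 z (1 - x * y)
    + tI31 z ((1 - y) / (1 - x * y))

/-- `Sym₃₆(a,b) := I_{3,1}(a,b) - Ĩ_{3,1}(a,b)` (on the level of symbols). -/
def S36 (a b : F) : TP F 4 := SI31 a b - tI31 a b

/-! ### Generic vectors -/

variable (N m : ℕ)

/-- Polynomial ring on the entries of `N` generic vectors in `m`-space. -/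
abbrev Pol : Type := MvPolynomial (Fin N × Fin m) ℚ

/-- The field of rational functions in the entries of `N` generic vectors in `m`-space. -/
abbrev FF : Type := FractionRing (Pol N m)

/-- The `j`-th coordinate of the `i`-th generic vector. -/
def gen (i : Fin N) (j : Fin m) : FF N m :=
  algebraMap (Pol N m) (FF N m) (MvPolynomial.X (i, j))

/-- `⟨i₁ … i_m⟩`: the determinant of the matrix whose columns are
the generic vectors selected by `cols`. -/
def dets (cols : Fin m → Fin N) : FF N m :=
  (Matrix.of fun r c => gen N m (cols c) r).det

/-- The field automorphism of `FF N m` induced by a permutation of the `N` vectors. -/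
def permAut (σ : Equiv.Perm (Fin N)) : FF N m ≃+* FF N m :=
  IsFractionRing.ringEquivOfRingEquiv
    ((MvPolynomial.renameEquiv ℚ (σ.prodCongr (Equiv.refl (Fin m)))).toRingEquiv)

variable {N m}

/-- Skew-symmetrization over all permutations of the `N` generic vectors. -/
def Alt {n : ℕ} (x : TP (FF N m) n) : TP (FF N m) n :=
  ∑ σ : Equiv.Perm (Fin N), (((Equiv.Perm.sign σ : ℤˣ) : ℤ) : ℚ) • tpMap (permAut N m σ) x

end GrassPoly

end

namespace GrassPoly

noncomputable section TwoVar

/-- The rational function field `ℚ(x, y)`. -/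
abbrev K2 : Type := FractionRing (MvPolynomial (Fin 2) ℚ)

/-- The variable `x`. -/
def xx : K2 := algebraMap (MvPolynomial (Fin 2) ℚ) K2 (MvPolynomial.X 0)

/-- The variable `y`. -/
def yy : K2 := algebraMap (MvPolynomial (Fin 2) ℚ) K2 (MvPolynomial.X 1)

end TwoVar

end GrassPoly

open GrassPoly

namespace GrassPoly

section TensorPowers

variable {F : Type} [Field F]

/-- The pure tensor `p ⊗ q ⊗ r ⊗ s`, built by successively appending factors. -/
noncomputable def pure4 (p q r s : VF F) : TP F 4 :=
  snoc (snoc (snoc (snoc (tprod ℚ (fun i : Fin 0 => i.elim0)) p) q) r) s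

theorem snoc_tprod {n : ℕ} (f : Fin n → VF F) (v : VF F) :
    snoc (tprod ℚ f) v = tprod ℚ (Fin.snoc f v : Fin (n + 1) → VF F) := by
  simp [snoc]

theorem pure4_eq_tprod (p q r s : VF F) : pure4 p q r s = tprod ℚ ![p, q, r, s] := by
  unfold pure4
  simp only [snoc_tprod]
  congr 1
  funext i
  fin_cases i <;> rfl

theorem splitLast_tprod {n : ℕ} (f : Fin (n + 1) → VF F) :
    splitLast n (tprod ℚ f) = tprod ℚ (Fin.init f) ⊗ₜ[ℚ] f (Fin.last n) := by
  unfold splitLast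
  simp only [LinearEquiv.trans_apply]
  erw [PiTensorProduct.reindex_tprod]
  erw [PiTensorProduct.tmulEquiv_symm_apply]
  simp only [TensorProduct.congr_tmul, LinearEquiv.refl_apply]
  erw [PiTensorProduct.subsingletonEquiv_apply_tprod]
  rfl

theorem splitLast_snoc {n : ℕ} (w : TP F n) (v : VF F) :
    splitLast n (snoc w v) = w ⊗ₜ[ℚ] v := by
  induction w using PiTensorProduct.induction_on with
  | smul_tprod r f =>
    simp only [map_smul, LinearMap.smul_apply, snoc_tprod, splitLast_tprod, Fin.init_snoc,
      Fin.snoc_last, TensorProduct.smul_tmul']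
  | add a b ha hb => simp only [map_add, LinearMap.add_apply, ha, hb, TensorProduct.add_tmul]

theorem splitLast_symm_tmul {n : ℕ} (w : TP F n) (v : VF F) :
    (splitLast n).symm (w ⊗ₜ[ℚ] v) = snoc w v := by
  rw [LinearEquiv.symm_apply_eq, splitLast_snoc]

theorem Pit_tprod {n : ℕ} (f : Fin (n + 2) → VF F) :
    Pit (n + 2) (tprod ℚ f) =
      snoc (Pit (n + 1) (tprod ℚ (Fin.init f))) (f (Fin.last (n + 1)))
        - snoc (Pit (n + 1) (tprod ℚ (Fin.tail f))) (f 0) := by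
  have hrot : rotN (n + 2) (tprod ℚ f) =
      tprod ℚ (Fin.snoc (Fin.tail f) (f 0) : Fin (n + 2) → VF F) := by
    unfold rotN
    erw [PiTensorProduct.reindex_tprod]
    congr 1
    funext i
    refine Fin.lastCases ?_ (fun j => ?_) i
    · simp
    · simp [Fin.tail]
  simp [Pit, hrot, splitLast_tprod, splitLast_symm_tmul]

theorem Pit_pure4 (p q r s : VF F) :
    Pit 4 (pure4 p q r s) =
      pure4 p q r s - pure4 q r s p - pure4 q r p s + pure4 r s q p
        - pure4 q p r s + pure4 r q s p + pure4 r q p s - pure4 s r q p := by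
  have h4 (p q r s : VF F) : (Fin.init ![p, q, r, s] : Fin 3 → VF F) = ![p, q, r] := by
    funext i
    fin_cases i <;> rfl
  have h3 (p q r : VF F) : (Fin.init ![p, q, r] : Fin 2 → VF F) = ![p, q] := by
    funext i
    fin_cases i <;> rfl
  have h2 (p q : VF F) : (Fin.init ![p, q] : Fin 1 → VF F) = ![p] := by
    funext i
    fin_cases i
    rfl
  have h1 (p : VF F) : tprod ℚ ![p] = snoc (tprod ℚ (fun i : Fin 0 => i.elim0)) p := by
    rw [snoc_tprod]
    congr 1
    funext i
    fin_cases i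
    rfl
  have hPit (w : TP F 1) : Pit 1 w = w := rfl
  have t4 : (Fin.tail ![p, q, r, s] : Fin 3 → VF F) = ![q, r, s] := rfl
  have t3 (p q r : VF F) : (Fin.tail ![p, q, r] : Fin 2 → VF F) = ![q, r] := rfl
  have t2 (p q : VF F) : (Fin.tail ![p, q] : Fin 1 → VF F) = ![q] := rfl
  have l4 : (![p, q, r, s] : Fin 4 → VF F) (Fin.last 3) = s := rfl
  have l3 (p q r : VF F) : (![p, q, r] : Fin 3 → VF F) (Fin.last 2) = r := rfl
  have l2 (p q : VF F) : (![p, q] : Fin 2 → VF F) (Fin.last 1) = q := rfl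
  conv_lhs => rw [pure4_eq_tprod, Pit_tprod, h4, t4]
  simp only [Pit_tprod, h3, t3, h2, t2, hPit, h1, l4, l3, l2, Matrix.cons_val_zero, map_sub,
    LinearMap.sub_apply, pure4]
  abel

end TensorPowers

section Symbol

variable {F : Type} [Field F]

theorem cls_one : cls (1 : F) = 0 := by
  rw [cls, dif_neg one_ne_zero, Units.mk0_one, ofMul_one, TensorProduct.tmul_zero]

theorem cls_mul {a b : F} (ha : a ≠ 0) (hb : b ≠ 0) : cls (a * b) = cls a + cls b := by
  rw [cls, cls, cls, dif_neg ha, dif_neg hb, dif_neg (mul_ne_zero ha hb), Units.mk0_mul,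
    ofMul_mul, TensorProduct.tmul_add]

theorem cls_inv (a : F) : cls a⁻¹ = -cls a := by
  rcases eq_or_ne a 0 with rfl | ha
  · simp [cls]
  · rw [eq_neg_iff_add_eq_zero, ← cls_mul (inv_ne_zero ha) ha, inv_mul_cancel₀ ha, cls_one]

theorem cls_neg (a : F) : cls (-a) = cls a := by
  rcases eq_or_ne a 0 with rfl | ha
  · rw [neg_zero]
  · have h : cls (-1 : F) = 0 := by
      have h2 : cls (-1 : F) + cls (-1 : F) = 0 := by
        rw [← cls_mul (neg_ne_zero.2 one_ne_zero) (neg_ne_zero.2 one_ne_zero), neg_mul_neg,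
          one_mul, cls_one]
      rw [← two_smul ℚ] at h2
      exact (smul_eq_zero.1 h2).resolve_left two_ne_zero
    rw [← neg_one_mul, cls_mul (neg_ne_zero.2 one_ne_zero) ha, h, zero_add]

theorem cls_sub_comm (a b : F) : cls (a - b) = cls (b - a) := by
  rw [← cls_neg, neg_sub]

theorem cls_div {a b : F} (ha : a ≠ 0) (hb : b ≠ 0) : cls (a / b) = cls a - cls b := by
  rw [div_eq_mul_inv, cls_mul ha (inv_ne_zero hb), cls_inv, sub_eq_add_neg]

theorem SIaux_one (a p b : F) (h : [p].length = 1) :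
    SIaux 1 a [p] b h = snoc (tprod ℚ (fun i : Fin 0 => i.elim0)) (tCoef a p b) := by
  rw [SIaux, Fin.sum_univ_one]
  rfl

theorem SIaux_two (a p q b : F) (h : [p, q].length = 2) :
    SIaux 2 a [p, q] b h =
      snoc (SIaux 1 a [q] b rfl) (tCoef a p q) + snoc (SIaux 1 a [p] b rfl) (tCoef p q b) := by
  rw [SIaux, Fin.sum_univ_two]
  rfl

theorem SIaux_three (a p q r b : F) (h : [p, q, r].length = 3) :
    SIaux 3 a [p, q, r] b h =
      snoc (SIaux 2 a [q, r] b rfl) (tCoef a p q) + snoc (SIaux 2 a [p, r] b rfl) (tCoef p q r)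
        + snoc (SIaux 2 a [p, q] b rfl) (tCoef q r b) := by
  rw [SIaux, Fin.sum_univ_three]
  rfl

theorem SIaux_four (a p q r s b : F) (h : [p, q, r, s].length = 4) :
    SIaux 4 a [p, q, r, s] b h =
      snoc (SIaux 3 a [q, r, s] b rfl) (tCoef a p q)
        + snoc (SIaux 3 a [p, r, s] b rfl) (tCoef p q r)
        + snoc (SIaux 3 a [p, q, s] b rfl) (tCoef q r s)
        + snoc (SIaux 3 a [p, q, r] b rfl) (tCoef r s b) := by
  rw [SIaux, Fin.sum_univ_four]
  rfl

theorem SI31_eq {x y : F} (hx0 : x ≠ 0) (hx1 : x ≠ 1) (hy0 : y ≠ 0) (hy1 : y ≠ 1) (hxy : x ≠ y) :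
    SI31 x y =
      pure4 (cls (1 - y) - cls y) (cls (x - y) - cls x) (cls y - cls x) (cls y - cls x)
      + pure4 (cls (1 - x) - cls x) (cls (1 - y) - cls (x - y)) (cls y - cls x) (cls y - cls x)
      - pure4 (cls (1 - x) - cls x) (cls x) (cls (1 - y) - cls y) (cls y - cls x)
      + pure4 (cls (1 - x) - cls x) (cls x) (cls x) (cls (1 - y) - cls y) := by
  have hx1' : 1 - x ≠ 0 := sub_ne_zero.2 hx1.symm
  have hy1' : 1 - y ≠ 0 := sub_ne_zero.2 hy1.symm
  have hyx' : y - x ≠ 0 := sub_ne_zero.2 hxy.symm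
  have hxy' : x - y ≠ 0 := sub_ne_zero.2 hxy
  have hyx : cls (y - x) = cls (x - y) := cls_sub_comm _ _
  rw [SI31, SIaux_four]
  simp only [SIaux_three, SIaux_two, SIaux_one]
  simp only [tCoef, hx0, hx1, hy1, hxy, hx0.symm, hy0.symm, if_true, if_false, sub_zero,
    zero_sub, zero_ne_one, cls_neg, cls_one, cls_div, hx1', hy1', hyx', hxy', hyx, ne_eq,
    neg_eq_zero, hy0, not_false_eq_true, one_ne_zero, pure4, map_add, map_sub,
    map_neg, map_zero, LinearMap.add_apply, LinearMap.sub_apply, LinearMap.neg_apply,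
    LinearMap.zero_apply]
  abel

theorem Pit_SI31_swap {x y : F} (hx0 : x ≠ 0) (hx1 : x ≠ 1) (hy0 : y ≠ 0) (hy1 : y ≠ 1)
    (hxy : x ≠ y) : Pit 4 (SI31 y x) = -Pit 4 (SI31 x y) := by
  rw [eq_neg_iff_add_eq_zero, SI31_eq hx0 hx1 hy0 hy1 hxy, SI31_eq hy0 hy1 hx0 hx1 hxy.symm,
    cls_sub_comm y x]
  obtain ⟨u, hu⟩ : ∃ u, u = cls (1 - x) - cls x := ⟨_, rfl⟩
  obtain ⟨v, hv⟩ : ∃ v, v = cls (1 - y) - cls y := ⟨_, rfl⟩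
  obtain ⟨z, hz⟩ : ∃ z, z = cls y - cls x := ⟨_, rfl⟩
  obtain ⟨e, he⟩ : ∃ e, e = cls (x - y) := ⟨_, rfl⟩
  obtain ⟨a, ha⟩ : ∃ a, a = cls x := ⟨_, rfl⟩
  have hz' : cls x - cls y = -z := by rw [hz, neg_sub]
  have hy : cls y = z + a := by rw [hz, ha, sub_add_cancel]
  have h1x : cls (1 - x) = u + a := by rw [hu, ha, sub_add_cancel]
  have h1y : cls (1 - y) = v + (z + a) := by rw [hv, ← hy, sub_add_cancel]
  rw [← hu, ← hv, ← hz, hz', h1x, h1y, hy, ← he, ← ha]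
  simp only [map_add, map_sub, Pit_pure4]
  simp only [pure4, map_add, map_sub, map_neg, LinearMap.add_apply, LinearMap.sub_apply,
    LinearMap.neg_apply]
  abel

end Symbol

section Anharmonic

variable {F : Type} [Field F]

theorem anhList_ne {x : F} (hx0 : x ≠ 0) (hx1 : x ≠ 1) {p : ℚ × F} (hp : p ∈ anhList x) :
    p.2 ≠ 0 ∧ p.2 ≠ 1 := by
  have hx1' : x - 1 ≠ 0 := sub_ne_zero.2 hx1
  have hx1'' : 1 - x ≠ 0 := sub_ne_zero.2 hx1.symm
  simp only [anhList, List.mem_cons, List.not_mem_nil, or_false] at hp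
  rcases hp with rfl | rfl | rfl | rfl | rfl | rfl
  · exact ⟨hx0, hx1⟩
  · exact ⟨inv_ne_zero hx1'', fun h => hx0 (by simpa using inv_eq_one.1 h)⟩
  · exact ⟨sub_ne_zero.2 fun h => hx1 (inv_eq_one.1 h.symm), by simpa using hx0⟩
  · exact ⟨inv_ne_zero hx0, fun h => hx1 (inv_eq_one.1 h)⟩
  · exact ⟨hx1'', by simpa using hx0⟩
  · refine ⟨div_ne_zero hx0 hx1', fun h => one_ne_zero (α := F) ?_⟩
    rw [div_eq_one_iff_eq hx1'] at h
    linear_combination h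

/-- The `j`-invariant, up to a constant, of the elliptic curve with Legendre parameter `x`. -/
def jInv (x : F) : F := (x ^ 2 - x + 1) ^ 3 / (x ^ 2 * (x - 1) ^ 2)

theorem jInv_eq_of_mem_anhList {x : F} (hx0 : x ≠ 0) (hx1 : x ≠ 1) {p : ℚ × F}
    (hp : p ∈ anhList x) : jInv p.2 = jInv x := by
  have hx1' : x - 1 ≠ 0 := sub_ne_zero.2 hx1
  have hx1'' : 1 - x ≠ 0 := sub_ne_zero.2 hx1.symm
  have h0 := anhList_ne hx0 hx1 hp
  have h1 := sub_ne_zero.2 h0.2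
  rw [jInv, jInv, div_eq_div_iff (by simp [h0.1, h1]) (by simp [hx0, hx1'])]
  clear h0 h1
  simp only [anhList, List.mem_cons, List.not_mem_nil, or_false] at hp
  rcases hp with rfl | rfl | rfl | rfl | rfl | rfl <;> dsimp only <;> field_simp <;> ring

theorem sum_anhList_of_mem {M : Type*} [AddCommGroup M] [Module ℚ M] (f : F → M) {x : F}
    (hx0 : x ≠ 0) (hx1 : x ≠ 1) {p : ℚ × F} (hp : p ∈ anhList x) :
    ((anhList p.2).map fun q => q.1 • f q.2).sum =
      p.1 • ((anhList x).map fun q => q.1 • f q.2).sum := by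
  have hx1' : x - 1 ≠ 0 := sub_ne_zero.2 hx1
  have hx1'' : 1 - x ≠ 0 := sub_ne_zero.2 hx1.symm
  have e1 : 1 - (1 - x)⁻¹ = x / (x - 1) := by field_simp; ring
  have e2 : 1 - x / (x - 1) = (1 - x)⁻¹ := by field_simp; ring
  have e3 : x⁻¹ / (x⁻¹ - 1) = (1 - x)⁻¹ := by
    have : x⁻¹ - 1 ≠ 0 := by simpa [sub_eq_zero] using hx1
    field_simp
  have e4 : (1 - x⁻¹)⁻¹ = x / (x - 1) := by
    rw [← inv_div]
    congr 1
    field_simp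
  have e5 : (1 - x⁻¹) / (1 - x⁻¹ - 1) = 1 - x := by field_simp; ring
  have e6 : (1 - x)⁻¹ / ((1 - x)⁻¹ - 1) = x⁻¹ := by
    have : (1 - x)⁻¹ - 1 = x / (1 - x) := by field_simp; ring
    rw [this]
    field_simp
  have e7 : (1 - x) / (1 - x - 1) = 1 - x⁻¹ := by
    have : 1 - x - 1 = -x := by ring
    rw [this]
    field_simp
    ring
  have e8 : x / (x - 1) / (x / (x - 1) - 1) = x := by
    have : x / (x - 1) - 1 = 1 / (x - 1) := by field_simp; ring
    rw [this]
    field_simp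
  have e9 : (x - 1) / x = 1 - x⁻¹ := by field_simp
  simp only [anhList, List.mem_cons, List.not_mem_nil, or_false] at hp
  rcases hp with rfl | rfl | rfl | rfl | rfl | rfl <;>
    simp only [anhList, List.map_cons, List.map_nil, List.sum_cons, List.sum_nil, e1, e2, e3, e4,
      e5, e6, e7, e8, e9, inv_inv, sub_sub_cancel, inv_div, one_smul, neg_smul] <;>
    abel

theorem tI31_eq_sum (x y : F) :
    tI31 x y = (36 : ℚ)⁻¹ • ((anhList x).map fun p =>
      p.1 • ((anhList y).map fun q => q.1 • SI31 p.2 q.2).sum).sum := by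
  simp only [tI31, mul_smul, List.smul_sum, List.map_map, Function.comp_def]

theorem tI31_of_mem_anhList {x y : F} (hx0 : x ≠ 0) (hx1 : x ≠ 1) (hy0 : y ≠ 0) (hy1 : y ≠ 1)
    {p q : ℚ × F} (hp : p ∈ anhList x) (hq : q ∈ anhList y) :
    tI31 p.2 q.2 = (p.1 * q.1) • tI31 x y := by
  simp only [tI31_eq_sum, sum_anhList_of_mem _ hy0 hy1 hq]
  rw [sum_anhList_of_mem (fun a => q.1 • ((anhList y).map fun b => b.1 • SI31 a b.2).sum)
    hx0 hx1 hp]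
  simp only [anhList, List.map_cons, List.map_nil, List.sum_cons, List.sum_nil]
  module

theorem Pit_tI31_swap {x y : F} (hx0 : x ≠ 0) (hx1 : x ≠ 1) (hy0 : y ≠ 0) (hy1 : y ≠ 1)
    (hxy : jInv x ≠ jInv y) : Pit 4 (tI31 y x) = -Pit 4 (tI31 x y) := by
  have key : ∀ p ∈ anhList x, ∀ q ∈ anhList y,
      Pit 4 (SI31 q.2 p.2) = -Pit 4 (SI31 p.2 q.2) := by
    intro p hp q hq
    obtain ⟨hp0, hp1⟩ := anhList_ne hx0 hx1 hp
    obtain ⟨hq0, hq1⟩ := anhList_ne hy0 hy1 hq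
    refine Pit_SI31_swap hp0 hp1 hq0 hq1 fun h => hxy ?_
    rw [← jInv_eq_of_mem_anhList hx0 hx1 hp, h, jInv_eq_of_mem_anhList hy0 hy1 hq]
  simp only [anhList, List.forall_mem_cons, List.not_mem_nil, false_imp_iff, implies_true,
    and_true] at key
  simp only [tI31, anhList, List.map_cons, List.map_nil, List.sum_cons, List.sum_nil, map_add,
    map_smul, map_zero, key]
  module

end Anharmonic

section TwoVariables

theorem algebraMap_K2_ne {p q : MvPolynomial (Fin 2) ℚ} (v : Fin 2 → ℚ)
    (h : MvPolynomial.eval v p ≠ MvPolynomial.eval v q) :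
    algebraMap _ K2 p ≠ algebraMap _ K2 q :=
  fun he => h (congrArg _ (IsFractionRing.injective _ K2 he))

theorem xx_ne_zero : xx ≠ 0 := by
  rw [xx, ← map_zero (algebraMap (MvPolynomial (Fin 2) ℚ) K2)]
  exact algebraMap_K2_ne 1 (by simp)

theorem yy_ne_zero : yy ≠ 0 := by
  rw [yy, ← map_zero (algebraMap (MvPolynomial (Fin 2) ℚ) K2)]
  exact algebraMap_K2_ne 1 (by simp)

theorem xx_ne_one : xx ≠ 1 := by
  rw [xx, ← map_one (algebraMap (MvPolynomial (Fin 2) ℚ) K2)]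
  exact algebraMap_K2_ne 0 (by simp)

theorem yy_ne_one : yy ≠ 1 := by
  rw [yy, ← map_one (algebraMap (MvPolynomial (Fin 2) ℚ) K2)]
  exact algebraMap_K2_ne 0 (by simp)

theorem jInv_xx_ne_jInv_yy : jInv xx ≠ jInv yy := by
  have hx := sub_ne_zero.2 xx_ne_one
  have hy := sub_ne_zero.2 yy_ne_one
  rw [jInv, jInv, Ne, div_eq_div_iff (by simp [xx_ne_zero, hx]) (by simp [yy_ne_zero, hy])]
  simp only [xx, yy, ← map_pow, ← map_mul, ← map_sub, ← map_add,
    ← map_one (algebraMap (MvPolynomial (Fin 2) ℚ) K2)]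
  refine algebraMap_K2_ne ![2, 5] ?_
  simp
  norm_num

end TwoVariables

end GrassPoly

/-- Proposition `i31tilde`, symmetries: `Ĩ_{3,1}` transforms by
`sgn(σ)sgn(π)` under the anharmonic action on either argument, and is antisymmetric. -/
theorem i31tilde_symmetries :
    (∀ p ∈ anhList xx, ∀ q ∈ anhList yy,
        Pit 4 (tI31 p.2 q.2) = (p.1 * q.1) • Pit 4 (tI31 xx yy)) ∧
      Pit 4 (tI31 yy xx) = - Pit 4 (tI31 xx yy) := by
  exact ⟨fun p hp q hq => by
    rw [tI31_of_mem_anhList xx_ne_zero xx_ne_one yy_ne_zero yy_ne_one hp hq, map_smul],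
    Pit_tI31_swap xx_ne_zero xx_ne_one yy_ne_zero yy_ne_one jInv_xx_ne_jInv_yy⟩
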